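/- arXiv:2602.01292 — 6 statements merged into one kernel-verified Lean document; each statement's English description precedes it below -/
import Mathlib

section
/- In a cograph Γ = (V, E), two vertices x and y are connected (i.e., related by the equivalence relation generated by E) if and only if there exists a vertex w ∈ V such that both (x, w) and (w, y) lie in the reflexive hull of E. -/
/-- A graph `(V, E)` (with `E` a symmetric relation, loops permitted) is a *cograph*
iff for all `w, x, y, z`, if `(w,x) ∈ E`, `(y,x) ∈ E` and `(y,z) ∈ E`, then
`(y,w) ∈ E` or `(w,z) ∈ E` or `(z,x) ∈ E`. -/
def IsCograph {V : Type*} (E : V → V → Prop) : Prop :=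
  ∀ w x y z : V, E w x → E y x → E y z → E y w ∨ E w z ∨ E z x

/-- In a cograph, the ends of a walk of length three are joined by a walk of length at most two. -/
theorem IsCograph.exists_common_neighbor_of_walk {V : Type*} {E : V → V → Prop}
    (hco : IsCograph E) (hsymm : Symmetric E) {a b c d : V}
    (hab : E a b) (hbc : E b c) (hcd : E c d) :
    ∃ w : V, (E a w ∨ a = w) ∧ (E w d ∨ w = d) := by
  rcases hco a b c d hab (hsymm hbc) hcd with h | h | h
  · exact ⟨c, .inl (hsymm h), .inl hcd⟩
  · exact ⟨a, .inr rfl, .inl h⟩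
  · exact ⟨b, .inl hab, .inl (hsymm h)⟩

/-- In a cograph, being at distance at most two is a transitive relation. -/
theorem IsCograph.exists_common_neighbor_trans {V : Type*} {E : V → V → Prop}
    (hco : IsCograph E) (hsymm : Symmetric E) {x y z : V}
    (hxy : ∃ w : V, (E x w ∨ x = w) ∧ (E w y ∨ w = y))
    (hyz : ∃ w : V, (E y w ∨ y = w) ∧ (E w z ∨ w = z)) :
    ∃ w : V, (E x w ∨ x = w) ∧ (E w z ∨ w = z) := by
  obtain ⟨w, hxw, hwy⟩ := hxy
  obtain ⟨v, hyv, hvz⟩ := hyz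
  rcases hxw with hxw | rfl
  · rcases hwy with hwy | rfl
    · rcases hyv with hyv | rfl
      · rcases hvz with hvz | rfl
        · rcases hco x w y v hxw (hsymm hwy) hyv with h | h | h
          · exact hco.exists_common_neighbor_of_walk hsymm (hsymm h) hyv hvz
          · exact ⟨v, .inl h, .inl hvz⟩
          · exact hco.exists_common_neighbor_of_walk hsymm hxw (hsymm h) hvz
        · exact hco.exists_common_neighbor_of_walk hsymm hxw hwy hyv
      · rcases hvz with hvz | rfl
        · exact hco.exists_common_neighbor_of_walk hsymm hxw hwy hvz
        · exact ⟨w, .inl hxw, .inl hwy⟩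
    · rcases hyv with hyv | rfl
      · rcases hvz with hvz | rfl
        · exact hco.exists_common_neighbor_of_walk hsymm hxw hyv hvz
        · exact ⟨w, .inl hxw, .inl hyv⟩
      · exact ⟨w, .inl hxw, hvz⟩
  · rcases hwy with hwy | rfl
    · rcases hyv with hyv | rfl
      · rcases hvz with hvz | rfl
        · exact hco.exists_common_neighbor_of_walk hsymm hwy hyv hvz
        · exact ⟨y, .inl hwy, .inl hyv⟩
      · exact ⟨y, .inl hwy, hvz⟩
    · exact ⟨v, hyv, hvz⟩

/-- In a cograph `Γ = (V, E)`, two vertices `x` and `y` are connected (related by the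
equivalence relation generated by `E`) if and only if there exists `w ∈ V` such that
both `(x, w)` and `(w, y)` lie in the reflexive hull of `E`. -/
theorem connected_iff_common_neighbor {V : Type*} (E : V → V → Prop)
    (hsymm : Symmetric E) (hco : IsCograph E) (x y : V) :
    Relation.EqvGen E x y ↔ ∃ w : V, (E x w ∨ x = w) ∧ (E w y ∨ w = y) := by
  constructor
  · intro h
    induction h with
    | rel a b h => exact ⟨b, .inl h, .inr rfl⟩
    | refl a => exact ⟨a, .inr rfl, .inr rfl⟩
    | symm a b _ ih =>
      obtain ⟨w, haw, hwb⟩ := ih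
      exact ⟨w, hwb.elim (fun h => .inl (hsymm h)) (fun h => .inr h.symm),
        haw.elim (fun h => .inl (hsymm h)) (fun h => .inr h.symm)⟩
    | trans a b c _ _ hab hbc => exact hco.exists_common_neighbor_trans hsymm hab hbc
  · rintro ⟨w, hxw, hwy⟩
    have eqvGen_of {a b : V} (h : E a b ∨ a = b) : Relation.EqvGen E a b := by
      rcases h with h | rfl
      · exact .rel _ _ h
      · exact .refl _
    exact .trans _ _ _ (eqvGen_of hxw) (eqvGen_of hwy)
end

section
/- In a cograph Γ = (V, E), two vertices x and y are co-connected (i.e., related by the equivalence relation generated by the complement (V × V) ∖ E) if and only if there exists a vertex w ∈ V such that neither (x, w) nor (w, y) lies in the maximal irreflexive subgraph E ∖ {(v, v) : v ∈ V}. -/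
/-- In a cograph, a path of length three in the complement of the maximal irreflexive subgraph
can be shortened to a path of length two. -/
theorem IsCograph.exists_common_nonneighbor {V : Type*} {E : V → V → Prop}
    (hsymm : ∀ ⦃u v : V⦄, E u v → E v u) (hco : IsCograph E) {a b c d : V}
    (hab : ¬ (E a b ∧ a ≠ b)) (hbc : ¬ (E b c ∧ b ≠ c)) (hcd : ¬ (E c d ∧ c ≠ d)) :
    ∃ w : V, ¬ (E a w ∧ a ≠ w) ∧ ¬ (E w d ∧ w ≠ d) := by
  by_contra! h
  have hb := h b
  have hc := h c
  have hd := h d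
  have hpath := hco c a d b
  grind

/-- In a cograph `Γ = (V, E)`, two vertices `x` and `y` are co-connected (related by
the equivalence relation generated by the complement `(V × V) ∖ E`) if and only if
there exists `w ∈ V` such that neither `(x, w)` nor `(w, y)` lies in the maximal
irreflexive subgraph `E ∖ {(v, v) : v ∈ V}`. -/
theorem coconnected_iff_common_nonneighbor {V : Type*} (E : V → V → Prop)
    (hsymm : Symmetric E) (hco : IsCograph E) (x y : V) :
    Relation.EqvGen (fun a b => ¬ E a b) x y ↔
      ∃ w : V, ¬ (E x w ∧ x ≠ w) ∧ ¬ (E w y ∧ w ≠ y) := by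
  constructor
  · intro h
    induction h with
    | rel a b h => exact ⟨b, fun h' => h h'.1, fun h' => h'.2 rfl⟩
    | refl a => exact ⟨a, fun h' => h'.2 rfl, fun h' => h'.2 rfl⟩
    | symm a b _ ih =>
      obtain ⟨w, haw, hwb⟩ := ih
      exact ⟨w, fun h' => hwb ⟨hsymm h'.1, h'.2.symm⟩, fun h' => haw ⟨hsymm h'.1, h'.2.symm⟩⟩
    | trans a b c _ _ ihab ihbc =>
      obtain ⟨u, hau, hub⟩ := ihab
      obtain ⟨v, hbv, hvc⟩ := ihbc
      obtain ⟨w, haw, hwv⟩ := hco.exists_common_nonneighbor hsymm hau hub hbv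
      exact hco.exists_common_nonneighbor hsymm haw hwv hvc
  · have eqvGen_of_not {a b : V} (h : ¬ (E a b ∧ a ≠ b)) :
        Relation.EqvGen (fun a b => ¬ E a b) a b := by
      by_cases hab : a = b
      · exact hab ▸ .refl a
      · exact .rel _ _ fun hE => h ⟨hE, hab⟩
    rintro ⟨w, hxw, hwy⟩
    exact .trans _ _ _ (eqvGen_of_not hxw) (eqvGen_of_not hwy)
end

section
/- Let Γ be a finite cograph with at least two vertices. Then Γ is connected if and only if its depth is even, if and only if its co-depth is odd; and Γ is co-connected if and only if its depth is odd, if and only if its co-depth is even. -/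
/-- A *paw of depth `k`* in `(V, E)` is a sequence `x₁, …, x_k` of vertices with
`x₁ ≠ x₂` such that for all `1 ≤ i < j ≤ k`, `(x_i, x_j) ∈ E` iff `j` is even.
(Here `x : Fin k → V` is `0`-indexed, so index `j : Fin k` corresponds to `j + 1`.) -/
def IsPaw {V : Type*} (E : V → V → Prop) (k : ℕ) (x : Fin k → V) : Prop :=
  (∀ h : 2 ≤ k, x ⟨0, by omega⟩ ≠ x ⟨1, by omega⟩) ∧
    ∀ i j : Fin k, i < j → (E (x i) (x j) ↔ Even ((j : ℕ) + 1))

/-- A *co-paw of depth `k`* in `(V, E)` is a sequence `y₁, …, y_k` of vertices with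
`y₁ ≠ y₂` such that for all `i < j`, `(y_i, y_j) ∈ E` iff `j` is odd. -/
def IsCoPaw {V : Type*} (E : V → V → Prop) (k : ℕ) (x : Fin k → V) : Prop :=
  (∀ h : 2 ≤ k, x ⟨0, by omega⟩ ≠ x ⟨1, by omega⟩) ∧
    ∀ i j : Fin k, i < j → (E (x i) (x j) ↔ Odd ((j : ℕ) + 1))

/-- The *depth* of `(V, E)`: the supremum of the `k` for which there is a paw of
depth `k`. -/
noncomputable def depth {V : Type*} (E : V → V → Prop) : ℕ :=
  sSup {k : ℕ | ∃ x : Fin k → V, IsPaw E k x}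

/-- The *co-depth* of `(V, E)`: the supremum of the `k` for which there is a co-paw of
depth `k`. -/
noncomputable def codepth {V : Type*} (E : V → V → Prop) : ℕ :=
  sSup {k : ℕ | ∃ x : Fin k → V, IsCoPaw E k x}

/-- `S` splits into two nonempty parts with no `R`-related pair going across. -/
def IsSeparated {V : Type*} (R : V → V → Prop) (S : Set V) : Prop :=
  ∃ p : V → Prop, (∃ a ∈ S, p a) ∧ (∃ b ∈ S, ¬ p b) ∧ ∀ a ∈ S, ∀ b ∈ S, p a → ¬ p b → ¬ R a b

theorem IsSeparated.of_compl {V : Type*} {E : V → V → Prop} {S : Set V}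
    (h : IsSeparated (fun a b => ¬ ¬ E a b) S) : IsSeparated E S := by
  simpa only [not_not] using h

theorem IsSeparated.not_forall_eqvGen {V : Type*} {R : V → V → Prop}
    (h : IsSeparated R Set.univ) (hsymm : Symmetric R) :
    ¬ ∀ x y : V, Relation.EqvGen R x y := by
  obtain ⟨p, ⟨a, -, ha⟩, ⟨b, -, hb⟩, hp⟩ := h
  intro hc
  have key : ∀ x y, Relation.EqvGen R x y → (p x ↔ p y) := by
    intro x y hxy
    induction hxy with
    | rel x y hxy =>
      by_contra hne
      by_cases hx : p x
      · exact hp x trivial y trivial hx (fun hy => hne (iff_of_true hx hy)) hxy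
      · exact hp y trivial x trivial (by tauto) hx (hsymm hxy)
    | refl x => rfl
    | symm x y _ ih => exact ih.symm
    | trans x y z _ _ ih₁ ih₂ => exact ih₁.trans ih₂
  exact hb ((key a b (hc a b)).1 ha)

theorem IsCograph.compl {V : Type*} {E : V → V → Prop} (h : IsCograph E)
    (hsymm : Symmetric E) : IsCograph (fun a b => ¬ E a b) := by
  intro w x y z hwx hyx hyz
  by_contra! hc
  obtain ⟨hyw, hwz, hzx⟩ := hc
  rcases h y w z x hyw (hsymm hwz) hzx with h | h | h
  · exact hyz (hsymm h)
  · exact hyx h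
  · exact hwx (hsymm h)

/-- If `v` has a neighbour and a non-neighbour on one side of a cut of `S` and a neighbour on
the other side, then the non-neighbours of `v` on the first side are cut off from the rest. -/
theorem IsCograph.isSeparated_insert_of_mixed {V : Type*} {E : V → V → Prop} (hco : IsCograph E)
    (hsymm : Symmetric E) {S : Set V} {v : V} (p : V → Prop)
    (hp : ∀ a ∈ S, ∀ b ∈ S, p a → ¬ p b → ¬ E a b) {m b : V}
    (hm : m ∈ S) (hpm : p m) (hvm : ¬ E v m) (hb : b ∈ S) (hpb : ¬ p b) (hvb : E v b)
    (hv : v ∉ S) : IsSeparated E (insert v S) := by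
  refine ⟨fun x => x ∈ S ∧ p x ∧ ¬ E v x, ⟨m, Or.inr hm, hm, hpm, hvm⟩,
    ⟨v, Or.inl rfl, fun h => hv h.1⟩, ?_⟩
  rintro x - y hy ⟨hxS, hpx, hvx⟩ hny hxy
  rcases hy with rfl | hy
  · exact hvx (hsymm hxy)
  by_cases hpy : p y
  · have hvy : E v y := by by_contra hvy; exact hny ⟨hy, hpy, hvy⟩
    rcases hco x y v b hxy hvy hvb with h | h | h
    · exact hvx h
    · exact hp x hxS b hb hpx hpb h
    · exact hp y hy b hb hpy hpb (hsymm h)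
  · exact hp x hxS y hy hpx hpy hxy

theorem IsCograph.isSeparated_insert {V : Type*} {E : V → V → Prop} (hco : IsCograph E)
    (hsymm : Symmetric E) {S : Set V} {v : V} (hv : v ∉ S) (h : IsSeparated E S) :
    IsSeparated E (insert v S) ∨ IsSeparated (fun a b => ¬ E a b) (insert v S) := by
  obtain ⟨p, ⟨a, ha, hpa⟩, ⟨b, hb, hpb⟩, hp⟩ := h
  by_cases h₁ : ∃ a ∈ S, p a ∧ E v a
  swap
  · push Not at h₁
    refine Or.inl ⟨fun x => x ∈ S ∧ p x, ⟨a, Or.inr ha, ha, hpa⟩,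
      ⟨v, Or.inl rfl, fun h => hv h.1⟩, ?_⟩
    rintro x - y (rfl | hy) ⟨hx, hpx⟩ hny hxy
    · exact h₁ x hx hpx (hsymm hxy)
    · exact hp x hx y hy hpx (fun h => hny ⟨hy, h⟩) hxy
  by_cases h₂ : ∃ b ∈ S, ¬ p b ∧ E v b
  swap
  · push Not at h₂
    refine Or.inl ⟨fun x => x ∈ S ∧ ¬ p x, ⟨b, Or.inr hb, hb, hpb⟩,
      ⟨v, Or.inl rfl, fun h => hv h.1⟩, ?_⟩
    rintro x - y (rfl | hy) ⟨hx, hpx⟩ hny hxy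
    · exact h₂ x hx hpx (hsymm hxy)
    · exact hp y hy x hx (by by_contra h; exact hny ⟨hy, h⟩) hpx (hsymm hxy)
  by_cases h₃ : ∃ m ∈ S, ¬ E v m
  swap
  · push Not at h₃
    refine Or.inr ⟨fun x => x = v, ⟨v, Or.inl rfl, rfl⟩,
      ⟨a, Or.inr ha, fun h => hv (h ▸ ha)⟩, ?_⟩
    rintro x - y (rfl | hy) rfl hny
    · exact absurd rfl hny
    · exact not_not.2 (h₃ y hy)
  obtain ⟨a', ha', hpa', hva'⟩ := h₁
  obtain ⟨b', hb', hpb', hvb'⟩ := h₂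
  obtain ⟨m, hm, hvm⟩ := h₃
  left
  by_cases hpm : p m
  · exact hco.isSeparated_insert_of_mixed hsymm p hp hm hpm hvm hb' hpb' hvb' hv
  · exact hco.isSeparated_insert_of_mixed hsymm (fun x => ¬ p x)
      (fun x hx y hy hpx hpy hxy => hp y hy x hx (not_not.1 hpy) hpx (hsymm hxy))
      hm hpm hvm ha' (not_not.2 hpa') hva' hv

/-- Every nontrivial finite set of vertices of a cograph is disconnected or co-disconnected. -/
theorem IsCograph.isSeparated_or {V : Type*} {E : V → V → Prop} (hco : IsCograph E)
    (hsymm : Symmetric E) {S : Set V} (hfin : S.Finite) (hS : S.Nontrivial) :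
    IsSeparated E S ∨ IsSeparated (fun a b => ¬ E a b) S := by
  induction S, hfin using Set.Finite.induction_on with
  | empty => exact absurd hS Set.not_nontrivial_empty
  | @insert v S hv _ ih =>
    by_cases hn : S.Nontrivial
    · rcases ih hn with h | h
      · exact hco.isSeparated_insert hsymm hv h
      · rcases (hco.compl hsymm).isSeparated_insert (fun _ _ h h' => h (hsymm h')) hv h with h | h
        · exact Or.inr h
        · exact Or.inl h.of_compl
    · rw [Set.not_nontrivial_iff] at hn
      obtain ⟨u, hu, huv⟩ := hS.exists_ne v
      have huS : u ∈ S := hu.resolve_left huv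
      have sep : ∀ R : V → V → Prop, ¬ R v u → IsSeparated R (insert v S) := by
        intro R hR
        refine ⟨fun x => x = v, ⟨v, Or.inl rfl, rfl⟩, ⟨u, hu, huv⟩, ?_⟩
        rintro x - y (rfl | hy) rfl hny
        · exact absurd rfl hny
        · rwa [hn hy huS]
      by_cases hE : E v u
      · exact Or.inr (sep _ (not_not.2 hE))
      · exact Or.inl (sep _ hE)

theorem IsCograph.not_connected_and_coconnected {V : Type*} [Finite V] {E : V → V → Prop}
    (hco : IsCograph E) (hsymm : Symmetric E) (htwo : ∃ x y : V, x ≠ y) :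
    ¬ ((∀ x y : V, Relation.EqvGen E x y) ∧
      ∀ x y : V, Relation.EqvGen (fun a b => ¬ E a b) x y) := by
  rintro ⟨h₁, h₂⟩
  obtain ⟨x, y, hxy⟩ := htwo
  rcases hco.isSeparated_or hsymm Set.finite_univ ⟨x, trivial, y, trivial, hxy⟩ with h | h
  · exact h.not_forall_eqvGen hsymm h₁
  · exact h.not_forall_eqvGen (fun _ _ h h' => h (hsymm h')) h₂

theorem IsPaw.injective {V : Type*} {E : V → V → Prop} (hsymm : Symmetric E) {k : ℕ}
    {x : Fin k → V} (hx : IsPaw E k x) : Function.Injective x := by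
  obtain ⟨hne, hx⟩ := hx
  have key : ∀ i j : Fin k, i < j → x i ≠ x j := by
    intro i j hij heq
    have hij' : (i : ℕ) < j := hij
    by_cases hj : (i : ℕ) + 1 = j
    · by_cases hi : (i : ℕ) = 0
      · apply hne (by omega)
        convert heq using 2 <;> ext <;> simp <;> omega
      · have h₁ := hx ⟨0, by omega⟩ i (Fin.lt_def.2 (Nat.pos_of_ne_zero hi))
        have h₂ := hx ⟨0, by omega⟩ j (Fin.lt_def.2 (by simp; omega))
        rw [heq, h₂, ← hj, Nat.even_add_one] at h₁
        tauto
    · have h₁ := hx ⟨i, by omega⟩ ⟨j - 1, by omega⟩ (Fin.lt_def.2 (by simp; omega))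
      have h₂ := hx ⟨j - 1, by omega⟩ j (Fin.lt_def.2 (by simp; omega))
      rw [show (⟨(j : ℕ) - 1, by omega⟩ : Fin k).val + 1 = j by simp; omega, heq] at h₁
      rw [Nat.even_add_one, ← h₁] at h₂
      have h₃ : ∀ a b, E a b ↔ E b a := fun a b => ⟨@hsymm a b, @hsymm b a⟩
      rw [h₃] at h₂
      tauto
  intro i j heq
  rcases lt_trichotomy i j with h | h | h
  · exact absurd heq (key i j h)
  · exact h
  · exact absurd heq.symm (key j i h)

theorem bddAbove_setOf_isPaw {V : Type*} [Fintype V] {E : V → V → Prop}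
    (hsymm : Symmetric E) : BddAbove {k : ℕ | ∃ x : Fin k → V, IsPaw E k x} := by
  refine ⟨Fintype.card V, ?_⟩
  rintro k ⟨x, hx⟩
  simpa using Fintype.card_le_of_injective x (hx.injective hsymm)

theorem exists_isPaw_depth {V : Type*} [Fintype V] {E : V → V → Prop}
    (hsymm : Symmetric E) : ∃ x : Fin (depth E) → V, IsPaw E (depth E) x :=
  Nat.sSup_mem (s := {k : ℕ | ∃ x : Fin k → V, IsPaw E k x})
    ⟨0, Fin.elim0, fun h => absurd h (by omega), fun i => i.elim0⟩ (bddAbove_setOf_isPaw hsymm)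

theorem IsPaw.le_depth {V : Type*} [Fintype V] {E : V → V → Prop} (hsymm : Symmetric E)
    {k : ℕ} {x : Fin k → V} (hx : IsPaw E k x) : k ≤ depth E :=
  le_csSup (bddAbove_setOf_isPaw hsymm) ⟨x, hx⟩

theorem IsPaw.snoc {V : Type*} {E : V → V → Prop} {k : ℕ} {x : Fin k → V} (hx : IsPaw E k x)
    {z : V} (hz : ∀ i, x i ≠ z) (hE : ∀ i, E (x i) z ↔ Even (k + 1)) :
    IsPaw E (k + 1) (Fin.snoc x z) := by
  constructor
  · intro h
    have h₀ : (⟨0, by omega⟩ : Fin (k + 1)) = Fin.castSucc ⟨0, by omega⟩ := rfl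
    rw [h₀, Fin.snoc_castSucc]
    by_cases hk : 2 ≤ k
    · have h₁ : (⟨1, by omega⟩ : Fin (k + 1)) = Fin.castSucc ⟨1, by omega⟩ := rfl
      rw [h₁, Fin.snoc_castSucc]
      exact hx.1 hk
    · have h₁ : (⟨1, by omega⟩ : Fin (k + 1)) = Fin.last k := by ext; simp; omega
      rw [h₁, Fin.snoc_last]
      exact hz _
  · intro i j hij
    induction j using Fin.lastCases with
    | last =>
      induction i using Fin.lastCases with
      | last => exact absurd hij (lt_irrefl _)
      | cast i => simpa using hE i
    | cast j =>
      induction i using Fin.lastCases with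
      | last => exact absurd hij (not_lt.2 (Fin.le_last _))
      | cast i => simpa using hx.2 i j hij

/-- A vertex outside the `R`-class containing a paw extends the paw, when `R` is the relation
holding between the last vertex of the paw and all earlier ones. -/
theorem forall_eqvGen_of_parity {V : Type*} [Fintype V] {E R : V → V → Prop}
    (hsymm : Symmetric E)
    (hlast : ∀ a b, (E a b ↔ Even (depth E)) → R a b)
    (hext : ∀ a b, ¬ R a b → (E a b ↔ Even (depth E + 1))) (x y : V) :
    Relation.EqvGen R x y := by
  by_contra hxy
  obtain ⟨w, hw⟩ := exists_isPaw_depth hsymm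
  have hclass : ∃ c, ∀ i, Relation.EqvGen R (w i) c := by
    rcases Nat.eq_zero_or_pos (depth E) with h₀ | h₀
    · exact ⟨x, fun i => absurd i.2 (by omega)⟩
    · refine ⟨w ⟨depth E - 1, by omega⟩, fun i => ?_⟩
      by_cases hi : (i : ℕ) = depth E - 1
      · rw [show i = ⟨depth E - 1, by omega⟩ from Fin.ext hi]
        exact .refl _
      · have h := hw.2 i ⟨depth E - 1, by omega⟩ (Fin.lt_def.2 (by simp; omega))
        rw [Nat.sub_add_cancel h₀] at h
        exact .rel _ _ (hlast _ _ h)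
  obtain ⟨c, hc⟩ := hclass
  have hout : ∃ z, ¬ Relation.EqvGen R z c := by
    by_contra! h
    exact hxy ((h x).trans _ _ _ ((h y).symm _ _))
  obtain ⟨z, hz⟩ := hout
  have hwz : ∀ i, ¬ Relation.EqvGen R (w i) z := fun i h =>
    hz ((h.symm _ _).trans _ _ _ (hc i))
  have hpaw := hw.snoc (z := z) (fun i h => hwz i (h ▸ .refl _))
    (fun i => hext _ _ fun h => hwz i (.rel _ _ h))
  exact absurd (hpaw.le_depth hsymm) (by omega)

theorem forall_eqvGen_of_even_depth {V : Type*} [Fintype V] {E : V → V → Prop}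
    (hsymm : Symmetric E) (h : Even (depth E)) (x y : V) : Relation.EqvGen E x y :=
  forall_eqvGen_of_parity hsymm (fun _ _ hab => hab.2 h)
    (fun _ _ hab => iff_of_false hab (by simpa [Nat.even_add_one] using h)) x y

theorem forall_eqvGen_compl_of_odd_depth {V : Type*} [Fintype V] {E : V → V → Prop}
    (hsymm : Symmetric E) (h : Odd (depth E)) (x y : V) :
    Relation.EqvGen (fun a b => ¬ E a b) x y := by
  rw [← Nat.not_even_iff_odd] at h
  exact forall_eqvGen_of_parity hsymm (fun _ _ hab hE => h (hab.1 hE))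
    (fun _ _ hab => iff_of_true (not_not.1 hab) (Nat.even_add_one.2 h)) x y

theorem codepth_eq_depth_compl {V : Type*} (E : V → V → Prop) :
    codepth E = depth (fun a b => ¬ E a b) := by
  have h : ∀ k (x : Fin k → V), IsCoPaw E k x ↔ IsPaw (fun a b => ¬ E a b) k x := fun k x => by
    simp only [IsCoPaw, IsPaw, ← Nat.not_even_iff_odd, not_iff_comm (a := E _ _)]
    simp only [iff_comm]
  simp only [codepth, depth, h]

/-- Let `Γ` be a finite cograph with at least two vertices.  Then `Γ` is connected iff
its depth is even, iff its co-depth is odd; and `Γ` is co-connected iff its depth is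
odd, iff its co-depth is even. -/
theorem cograph_connected_iff_depth_parity {V : Type*} [Fintype V]
    (E : V → V → Prop) (hsymm : Symmetric E) (hco : IsCograph E)
    (htwo : ∃ x y : V, x ≠ y) :
    ((∀ x y : V, Relation.EqvGen E x y) ↔ Even (depth E)) ∧
    ((∀ x y : V, Relation.EqvGen E x y) ↔ Odd (codepth E)) ∧
    ((∀ x y : V, Relation.EqvGen (fun a b => ¬ E a b) x y) ↔ Odd (depth E)) ∧
    ((∀ x y : V, Relation.EqvGen (fun a b => ¬ E a b) x y) ↔ Even (codepth E)) := by
  have hnot := hco.not_connected_and_coconnected hsymm htwo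
  have hsymm' : Symmetric (fun a b => ¬ E a b) := fun _ _ h h' => h (hsymm h')
  have h₁ := fun h => forall_eqvGen_of_even_depth hsymm h
  have h₂ := fun h => forall_eqvGen_compl_of_odd_depth hsymm h
  have h₃ := fun h => forall_eqvGen_of_even_depth hsymm' h
  have h₄ := fun h => forall_eqvGen_compl_of_odd_depth hsymm' h
  simp only [not_not] at h₄
  rw [codepth_eq_depth_compl]
  rw [← Nat.not_even_iff_odd] at h₂ h₄ ⊢
  rw [← Nat.not_even_iff_odd]
  tauto
end

section
/- The vertices of a paw are automatically pairwise distinct: if (V, E) is a graph (E symmetric) and x₁, …, x_k is a sequence of vertices with x₁ ≠ x₂ such that for all 1 ≤ i < j ≤ k one has (x_i, x_j) ∈ E iff j is even, then the x_i are pairwise distinct. -/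
/-- The vertices of a paw are automatically pairwise distinct: if `(V, E)` is a graph
(`E` symmetric) and `x₁, …, x_k` is a paw of depth `k`, then the `x_i` are pairwise
distinct. -/
theorem paw_injective {V : Type*} (E : V → V → Prop) (hsymm : Symmetric E)
    {k : ℕ} (x : Fin k → V) (hx : IsPaw E k x) :
    Function.Injective x := by
  obtain ⟨hne, hE⟩ := hx
  refine .of_lt_imp_ne fun i j hlt h => ?_
  have before (l : Fin k) (hl : l < i) : Even ((i : ℕ) + 1) ↔ Even ((j : ℕ) + 1) := by
    rw [← hE l i hl, ← hE l j (hl.trans hlt), h]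
  have between (m : Fin k) (him : i < m) (hmj : m < j) :
      Even ((m : ℕ) + 1) ↔ Even ((j : ℕ) + 1) := by
    rw [← hE i m him, ← hE m j hmj, h]
    exact ⟨fun e => hsymm e, fun e => hsymm e⟩
  obtain ⟨i, hi⟩ := i
  obtain ⟨j, hj⟩ := j
  simp only [Fin.mk_lt_mk, Fin.forall_iff, Nat.even_iff] at hlt before between
  rcases Nat.eq_zero_or_pos i with rfl | hpos
  · by_cases hj1 : j = 1
    · subst hj1
      exact hne (by omega) h
    · have h₁ := between 1 (by omega) (by omega) (by omega)
      have h₂ := between 2 (by omega) (by omega) (by omega)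
      omega
  · have h₁ := before (i - 1) (by omega) (by omega)
    have h₂ := between (i + 1) (by omega) (by omega)
    omega
end

section
/- For every k ≥ 2, the co-paw graph Paw^k has depth exactly k − 1. -/
/-- The loopless graph `Paw^k` on `{1, …, k}` (modelled on `Fin k`, with `i : Fin k`
representing the vertex `i + 1`): for `1 ≤ i < j ≤ k`, the pair `(i, j)` (together
with its transpose) is an edge iff `j` is odd. -/
def copawE (k : ℕ) : Fin k → Fin k → Prop := fun i j =>
  ((i : ℕ) < (j : ℕ) ∧ Odd ((j : ℕ) + 1)) ∨ ((j : ℕ) < (i : ℕ) ∧ Odd ((i : ℕ) + 1))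

/-- In a paw of `Paw^k`, the largest of the entries up to index `n ≥ 1` exceeds `n`, has parity
opposite to `n`, and is not equal to all of them. -/
theorem IsPaw.exists_max_copawE {k m : ℕ} {x : Fin m → Fin k} (hx : IsPaw (copawE k) m x)
    (n : ℕ) (hn : 1 ≤ n) (hnm : n < m) :
    ∃ i : Fin m, (i : ℕ) ≤ n ∧ n + 1 ≤ (x i : ℕ) ∧ Odd ((x i : ℕ) + n) ∧
      (∀ l : Fin m, (l : ℕ) ≤ n → (x l : ℕ) ≤ x i) ∧
      ∃ l : Fin m, (l : ℕ) ≤ n ∧ (x l : ℕ) < x i := by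
  obtain ⟨hne, hE⟩ := hx
  simp only [copawE, Fin.lt_def, Nat.odd_iff, Nat.even_iff] at hE ⊢
  induction n, hn using Nat.le_induction with
  | base =>
    have h0m : 0 < m := by omega
    have h01 := Fin.val_ne_of_ne (hne (by omega))
    have hadj := hE ⟨0, by omega⟩ ⟨1, by omega⟩ (by simp)
    have hle (l : Fin m) (hl : (l : ℕ) ≤ 1) : l = ⟨0, h0m⟩ ∨ l = ⟨1, hnm⟩ := by
      simp only [Fin.ext_iff]; omega
    simp only [Nat.reduceAdd, Nat.reduceMod, iff_true] at hadj
    rcases lt_or_gt_of_ne h01 with h | h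
    · refine ⟨⟨1, by omega⟩, le_rfl, by omega, by omega, fun l hl => ?_, ⟨0, by omega⟩, by simp, h⟩
      rcases hle l hl with rfl | rfl <;> omega
    · refine ⟨⟨0, by omega⟩, by simp, by omega, by omega, fun l hl => ?_, ⟨1, by omega⟩, le_rfl, h⟩
      rcases hle l hl with rfl | rfl <;> omega
  | succ n hn ih =>
    obtain ⟨i, hi, hlarge, hodd, hmax, l, hl, hlt⟩ := ih (by omega)
    have hadj_i := hE i ⟨n + 1, hnm⟩ (by simp only; omega)
    have hadj_l := hE l ⟨n + 1, hnm⟩ (by simp only; omega)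
    simp only at hadj_i hadj_l
    have hgt : (x i : ℕ) < x ⟨n + 1, hnm⟩ := by omega
    refine ⟨⟨n + 1, hnm⟩, le_rfl, by omega, by omega, fun j hj => ?_, i, by omega, hgt⟩
    rcases Nat.lt_or_ge n j with h | h
    · obtain rfl : j = ⟨n + 1, hnm⟩ := Fin.ext (by simp only; omega)
      exact le_rfl
    · exact (hmax j h).trans hgt.le

theorem IsPaw.lt_of_copawE {k m : ℕ} (hk : 2 ≤ k) {x : Fin m → Fin k}
    (hx : IsPaw (copawE k) m x) : m < k := by
  rcases Nat.lt_or_ge m 2 with h | h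
  · omega
  · obtain ⟨i, -, hi, -⟩ := hx.exists_max_copawE (m - 1) (by omega) (by omega)
    have := (x i).isLt
    omega

/-- The vertices other than the first form a paw of `Paw^k`. -/
theorem isPaw_copawE_succ (k : ℕ) :
    IsPaw (copawE k) (k - 1) fun i => ⟨i + 1, by omega⟩ := by
  refine ⟨fun h => by simp, fun i j hij => ?_⟩
  simp only [copawE, Fin.lt_def, Nat.odd_iff, Nat.even_iff] at hij ⊢
  omega

/-- For every `k ≥ 2`, the co-paw graph `Paw^k` has depth exactly `k − 1`. -/
theorem depth_copaw (k : ℕ) (hk : 2 ≤ k) : depth (copawE k) = k - 1 := by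
  refine IsGreatest.csSup_eq ⟨⟨_, isPaw_copawE_succ k⟩, ?_⟩
  rintro m ⟨x, hx⟩
  exact Nat.le_sub_one_of_lt (hx.lt_of_copawE hk)
end

section
/- A finite irreflexive graph Γ (symmetric edge relation with no loops) is a cograph if and only if, within every induced subgraph of Γ, every maximal clique intersects every maximal coclique (independent set); and in that case, any such intersection consists of a single vertex. -/
/-- A *clique*: a set of vertices any two distinct members of which are joined by an
edge. -/
def IsClique {V : Type*} (E : V → V → Prop) (s : Set V) : Prop :=
  ∀ a ∈ s, ∀ b ∈ s, a ≠ b → E a b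

/-- A *coclique* (independent set): a set of vertices no two distinct members of which
are joined by an edge. -/
def IsCoclique {V : Type*} (E : V → V → Prop) (s : Set V) : Prop :=
  ∀ a ∈ s, ∀ b ∈ s, a ≠ b → ¬ E a b

section

variable {V : Type*} {E : V → V → Prop} {W s t : Set V}

/-- A vertex adjacent to every vertex of a maximal clique lies in that clique. -/
theorem IsClique.mem_of_maximal (hsymm : ∀ ⦃x y⦄, E x y → E y x) (hs : IsClique E s) (hsW : s ⊆ W)
    (hmax : ∀ s' : Set V, s ⊆ s' → s' ⊆ W → IsClique E s' → s' = s)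
    {v : V} (hv : v ∈ W) (h : ∀ u ∈ s, u ≠ v → E u v) : v ∈ s := by
  rw [← hmax (insert v s) (Set.subset_insert v s) (Set.insert_subset hv hsW) ?_]
  · exact Set.mem_insert v s
  rintro a (rfl | ha) b (rfl | hb) hab
  · exact absurd rfl hab
  · exact hsymm (h b hb hab.symm)
  · exact h a ha hab
  · exact hs a ha b hb hab

/-- A vertex adjacent to no vertex of a maximal coclique lies in that coclique. -/
theorem IsCoclique.mem_of_maximal (hsymm : ∀ ⦃x y⦄, E x y → E y x) (ht : IsCoclique E t) (htW : t ⊆ W)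
    (hmax : ∀ t' : Set V, t ⊆ t' → t' ⊆ W → IsCoclique E t' → t' = t)
    {v : V} (hv : v ∈ W) (h : ∀ u ∈ t, ¬ E u v) : v ∈ t := by
  rw [← hmax (insert v t) (Set.subset_insert v t) (Set.insert_subset hv htW) ?_]
  · exact Set.mem_insert v t
  rintro a (rfl | ha) b (rfl | hb) hab
  · exact absurd rfl hab
  · exact fun e => h b hb (hsymm e)
  · exact h a ha
  · exact ht a ha b hb hab

/-- In a cograph, the neighbourhoods in a coclique of two vertices of a clique are comparable. -/
theorem IsCograph.neighbors_subset_or_subset (hE : IsCograph E) (hsymm : ∀ ⦃x y⦄, E x y → E y x)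
    (hs : IsClique E s) (ht : IsCoclique E t) {u v : V} (hu : u ∈ s) (hv : v ∈ s) :
    {a ∈ t | E u a} ⊆ {a ∈ t | E v a} ∨ {a ∈ t | E v a} ⊆ {a ∈ t | E u a} := by
  by_contra! h
  obtain ⟨⟨a, ⟨hat, hua⟩, hva⟩, ⟨b, ⟨hbt, hvb⟩, hub⟩⟩ :=
    And.intro (Set.not_subset.1 h.1) (Set.not_subset.1 h.2)
  have hva' : ¬ E v a := fun e => hva ⟨hat, e⟩
  have hub' : ¬ E u b := fun e => hub ⟨hbt, e⟩
  have huv : v ≠ u := by rintro rfl; exact hva' hua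
  have hab : a ≠ b := by rintro rfl; exact hub' hua
  rcases hE a u v b (hsymm hua) (hs v hv u hu huv) hvb with e | e | e
  · exact hva' e
  · exact ht a hat b hbt hab e
  · exact hub' (hsymm e)

theorem IsCograph.inter_nonempty [Finite V] (hE : IsCograph E) (hsymm : ∀ ⦃x y⦄, E x y → E y x)
    (hW : W.Nonempty) (hsW : s ⊆ W) (htW : t ⊆ W) (hs : IsClique E s) (ht : IsCoclique E t)
    (hsmax : ∀ s' : Set V, s ⊆ s' → s' ⊆ W → IsClique E s' → s' = s)
    (htmax : ∀ t' : Set V, t ⊆ t' → t' ⊆ W → IsCoclique E t' → t' = t) :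
    (s ∩ t).Nonempty := by
  have hne : s.Nonempty := by
    obtain ⟨w, hw⟩ := hW
    by_contra h
    rw [Set.not_nonempty_iff_eq_empty] at h
    have hmem := hs.mem_of_maximal hsymm hsW hsmax hw (by simp [h])
    simp [h] at hmem
  obtain ⟨v, hv⟩ := s.toFinite.exists_minimalFor (fun u => {a ∈ t | E u a}) s hne
  by_cases hvt : v ∈ t
  · exact ⟨v, hv.1, hvt⟩
  obtain ⟨a, hat, hav⟩ : ∃ a ∈ t, E a v := by
    by_contra! h
    exact hvt (ht.mem_of_maximal hsymm htW htmax (hsW hv.1) h)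
  refine ⟨a, hs.mem_of_maximal hsymm hsW hsmax (htW hat) fun u hu _ => ?_, hat⟩
  have hsub : {a ∈ t | E v a} ⊆ {a ∈ t | E u a} :=
    (hE.neighbors_subset_or_subset hsymm hs ht hv.1 hu).elim id fun h => hv.2 hu h
  exact (hsub ⟨hat, hsymm hav⟩).2

/-- The middle edge and the end vertices of an induced path on four vertices are a maximal clique
and a maximal coclique which are disjoint. -/
theorem isCograph_of_inter_nonempty (hsymm : ∀ ⦃x y⦄, E x y → E y x) (hirr : ∀ v : V, ¬ E v v)
    (h : ∀ W s t : Set V, W.Nonempty → s ⊆ W → t ⊆ W → IsClique E s → IsCoclique E t →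
      (∀ s' : Set V, s ⊆ s' → s' ⊆ W → IsClique E s' → s' = s) →
      (∀ t' : Set V, t ⊆ t' → t' ⊆ W → IsCoclique E t' → t' = t) →
      (s ∩ t).Nonempty) :
    IsCograph E := by
  intro w x y z hwx hyx hyz
  by_contra! ⟨hyw, hwz, hzx⟩
  have hyw' : y ≠ w := by rintro rfl; exact hwz hyz
  have hzx' : z ≠ x := by rintro rfl; exact hwz hwx
  have hwx' : w ≠ x := by rintro rfl; exact hirr _ hwx
  have hyz' : y ≠ z := by rintro rfl; exact hirr _ hyz
  obtain ⟨v, hv, hv'⟩ := h {w, x, y, z} {x, y} {w, z} ⟨w, by simp⟩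
    (by grind) (by grind)
    (by rintro a (rfl | rfl) b (rfl | rfl) hab
        exacts [absurd rfl hab, hsymm hyx, hyx, absurd rfl hab])
    (by rintro a (rfl | rfl) b (rfl | rfl) hab
        exacts [absurd rfl hab, hwz, fun e => hwz (hsymm e), absurd rfl hab])
    (by
      intro s' hs hsW hc
      refine Set.Subset.antisymm (fun a ha => ?_) hs
      have hx : x ∈ s' := hs (by simp)
      have hy : y ∈ s' := hs (by simp)
      rcases hsW ha with rfl | rfl | rfl | rfl
      · exact absurd (hc y hy a ha hyw') hyw
      · simp
      · simp
      · exact absurd (hc a ha x hx hzx') hzx)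
    (by
      intro t' ht htW hc
      refine Set.Subset.antisymm (fun a ha => ?_) ht
      have hw : w ∈ t' := ht (by simp)
      have hz : z ∈ t' := ht (by simp)
      rcases htW ha with rfl | rfl | rfl | rfl
      · simp
      · exact absurd hwx (hc w hw a ha hwx')
      · exact absurd hyz (hc a ha z hz hyz')
      · simp)
  grind

end

/-- A finite irreflexive graph `Γ` (symmetric edge relation, no loops) is a cograph
iff, within every (nonempty) induced subgraph, every maximal clique intersects every
maximal coclique; and in that case any such intersection consists of a single
vertex. -/
theorem isCograph_iff_maximal_clique_meets_coclique {V : Type*} [Fintype V]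
    (E : V → V → Prop) (hsymm : Symmetric E) (hirr : ∀ v : V, ¬ E v v) :
    (IsCograph E ↔
      ∀ W s t : Set V, W.Nonempty → s ⊆ W → t ⊆ W →
        IsClique E s → IsCoclique E t →
        (∀ s' : Set V, s ⊆ s' → s' ⊆ W → IsClique E s' → s' = s) →
        (∀ t' : Set V, t ⊆ t' → t' ⊆ W → IsCoclique E t' → t' = t) →
        (s ∩ t).Nonempty) ∧
    (IsCograph E →
      ∀ W s t : Set V, W.Nonempty → s ⊆ W → t ⊆ W →
        IsClique E s → IsCoclique E t →
        (∀ s' : Set V, s ⊆ s' → s' ⊆ W → IsClique E s' → s' = s) →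
        (∀ t' : Set V, t ⊆ t' → t' ⊆ W → IsCoclique E t' → t' = t) →
        ∃ v : V, s ∩ t = {v}) := by
  refine ⟨⟨fun hE W s t hW hsW htW hs ht hsmax htmax =>
      hE.inter_nonempty hsymm hW hsW htW hs ht hsmax htmax,
    isCograph_of_inter_nonempty hsymm hirr⟩, fun hE W s t hW hsW htW hs ht hsmax htmax => ?_⟩
  obtain ⟨v, hvs, hvt⟩ := hE.inter_nonempty hsymm hW hsW htW hs ht hsmax htmax
  refine ⟨v, Set.eq_singleton_iff_unique_mem.2 ⟨⟨hvs, hvt⟩, fun u hu => ?_⟩⟩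
  by_contra huv
  exact ht u hu.2 v hvt huv (hs u hu.1 v hvs huv)
end
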